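/- Consider the exclusive policy. For any profile P of k strategies that is at equilibrium and any single strategy A, success(P) ≥ success(A^k), where A^k is the symmetric profile of k copies of A. -/

import Mathlib

open Finset

/-- `A` is a doubly-substochastic `M × T` matrix: boxes `1..M`, rounds `1..T`,
nonnegative entries, every row and every column sums to at most 1. -/
def Substochastic (M T : ℕ) (A : ℕ → ℕ → ℝ) : Prop :=
  (∀ x t, 0 ≤ A x t) ∧
  (∀ x ∈ Icc 1 M, ∑ t ∈ Icc 1 T, A x t ≤ 1) ∧
  (∀ t ∈ Icc 1 T, ∑ x ∈ Icc 1 M, A x t ≤ 1)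

/-- `N̄_A(x,t)`: the probability that `A` does not visit box `x` by (and including) round `t`. -/
def Nbar (A : ℕ → ℕ → ℝ) (x t : ℕ) : ℝ := 1 - ∑ s ∈ Icc 1 t, A x s

/-- `f` is a positive, nonincreasing probability distribution on boxes `1..M`. -/
def BoxDist (M : ℕ) (f : ℕ → ℝ) : Prop :=
  (∀ x ∈ Icc 1 M, 0 < f x) ∧
  (∀ x, 1 ≤ x → x + 1 ≤ M → f (x + 1) ≤ f x) ∧
  (∑ x ∈ Icc 1 M, f x = 1)

/-- `C` is a congestion policy for `k` players: nonnegative, nonincreasing on `1..k`,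
`C 1 = 1`, and `C ℓ < 1` for some `ℓ ≤ k`. -/
def Policy (k : ℕ) (C : ℕ → ℝ) : Prop :=
  (∀ ℓ, 1 ≤ ℓ → ℓ ≤ k → 0 ≤ C ℓ) ∧ (C 1 = 1) ∧
  (∀ ℓ ℓ', 1 ≤ ℓ → ℓ ≤ ℓ' → ℓ' ≤ k → C ℓ' ≤ C ℓ) ∧
  (∃ ℓ, 1 ≤ ℓ ∧ ℓ ≤ k ∧ C ℓ < 1)

/-- The value of box `x` at round `t` against `k-1` copies of `A`. -/
def val (k : ℕ) (C f : ℕ → ℝ) (A : ℕ → ℕ → ℝ) (x t : ℕ) : ℝ :=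
  f x * ∑ ℓ ∈ range k,
    C (ℓ + 1) * ((k - 1).choose ℓ : ℝ) * A x t ^ ℓ * Nbar A x t ^ (k - 1 - ℓ)

/-- The utility of `B` against `k-1` copies of `A`. -/
def util (M T k : ℕ) (C f : ℕ → ℝ) (A B : ℕ → ℕ → ℝ) : ℝ :=
  ∑ t ∈ Icc 1 T, ∑ x ∈ Icc 1 M, B x t * val k C f A x t

/-- `A` is non-redundant: each column `t ≤ min T M` sums to exactly 1. -/
def NonRedundant (M T : ℕ) (A : ℕ → ℕ → ℝ) : Prop :=
  ∀ t, 1 ≤ t → t ≤ min T M → ∑ x ∈ Icc 1 M, A x t = 1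

/-- `A` is self-greedy: for each round `t ≤ T` it is greedy at round `t` with respect to
`k-1` copies of itself. -/
def SGreedy (M T k : ℕ) (C f : ℕ → ℝ) (A : ℕ → ℕ → ℝ) : Prop :=
  ∀ t, 1 ≤ t → t ≤ T → ∀ B, Substochastic M T B →
    (∀ x s, s < t → B x s = A x s) →
    ∑ x ∈ Icc 1 M, B x t * val k C f A x t ≤ ∑ x ∈ Icc 1 M, A x t * val k C f A x t

noncomputable instance : DecidableEq (ℕ → ℕ → ℝ) := Classical.decEq _

/-- The value of box `x` at round `t` against the profile `P` under the exclusive policy. -/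
def pexVal (f : ℕ → ℝ) (P : Multiset (ℕ → ℕ → ℝ)) (x t : ℕ) : ℝ :=
  f x * (P.map fun A => Nbar A x t).prod

/-- The utility of `B` against the profile `P` under the exclusive policy. -/
def pexUtil (M T : ℕ) (f : ℕ → ℝ) (P : Multiset (ℕ → ℕ → ℝ)) (B : ℕ → ℕ → ℝ) : ℝ :=
  ∑ t ∈ Icc 1 T, ∑ x ∈ Icc 1 M, B x t * pexVal f P x t

/-- The success probability of the profile `P`. -/
def success (M T : ℕ) (f : ℕ → ℝ) (P : Multiset (ℕ → ℕ → ℝ)) : ℝ :=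
  ∑ x ∈ Icc 1 M, f x * (1 - (P.map fun A => Nbar A x T).prod)

/-- A form of the AM-GM inequality for `a ^ n` together with `n - 1` numbers whose product is
at least `l / c`. -/
theorem card_mul_le_pow_add_sum {ι : Type*} (s : Finset ι) (y : ι → ℝ) {c l a : ℝ}
    (hc : 0 < c) (hl : 0 ≤ l) (ha : 0 ≤ a) (hy : ∀ i ∈ s, 0 ≤ y i)
    (hprod : l ≤ c * ∏ i ∈ s, y i) :
    ((#s : ℝ) + 1) * l * a ≤ c * a ^ (#s + 1) + l * ∑ i ∈ s, y i := by
  have hr : 0 ≤ l / c := div_nonneg hl hc.le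
  let z : Option ι → ℝ := fun o => o.elim (a ^ (#s + 1)) fun i => l / c * y i
  have hz : ∀ o ∈ insertNone s, 0 ≤ z o := by
    rintro (_ | i) ho
    · exact pow_nonneg ha _
    · exact mul_nonneg hr (hy i (some_mem_insertNone.1 ho))
  have amgm := Real.geom_mean_le_arith_mean (insertNone s) (fun _ => 1) z
    (fun _ _ => zero_le_one) (by simp; positivity) hz
  simp only [Real.rpow_one, one_mul, sum_const, card_insertNone, nsmul_eq_mul, mul_one,
    prod_insertNone, sum_insertNone] at amgm
  have hpow : (l / c * a) ^ (#s + 1) ≤ z none * ∏ i ∈ s, z (some i) := by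
    simp only [z, Option.elim, prod_mul_distrib, prod_const]
    have : l / c ≤ ∏ i ∈ s, y i := (div_le_iff₀' hc).2 hprod
    calc (l / c * a) ^ (#s + 1) = a ^ (#s + 1) * ((l / c) ^ #s * (l / c)) := by ring
      _ ≤ _ := by gcongr
  have hroot : l / c * a ≤ (z none * ∏ i ∈ s, z (some i)) ^ ((#s + 1 : ℕ) : ℝ)⁻¹ := by
    rw [← Real.pow_rpow_inv_natCast (mul_nonneg hr ha) (Nat.succ_ne_zero #s)]
    exact Real.rpow_le_rpow (by positivity) hpow (by positivity)
  have h := hroot.trans amgm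
  rw [le_div_iff₀ (by positivity)] at h
  simp only [z, Option.elim, ← mul_sum] at h
  push_cast at h
  have h' := mul_le_mul_of_nonneg_left h hc.le
  have hcr : c * (l / c) = l := mul_div_cancel₀ l hc.ne'
  calc ((#s : ℝ) + 1) * l * a = ((#s : ℝ) + 1) * (c * (l / c)) * a := by rw [hcr]
    _ = c * (l / c * a * (#s + 1)) := by ring
    _ ≤ c * (a ^ (#s + 1) + l / c * ∑ i ∈ s, y i) := h'
    _ = c * a ^ (#s + 1) + c * (l / c) * ∑ i ∈ s, y i := by ring
    _ = _ := by rw [hcr]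

/-- The bound on a single box, where `N m` is the probability that player `m` misses it and `a` the
probability that the competing strategy does. -/
theorem mul_prod_add_le {ι : Type*} [Fintype ι] [DecidableEq ι] (N : ι → ℝ) {c l a : ℝ}
    (hc : 0 < c) (hl : 0 < l) (ha : 0 ≤ a) (hN : ∀ i, 0 ≤ N i) (i j : ι)
    (hi : l ≤ c * ∏ m ∈ univ.erase i, N m)
    (hj : 0 < N j → c * ∏ m ∈ univ.erase j, N m ≤ l) :
    c * ∏ m, N m + Fintype.card ι * l * a ≤ c * a ^ Fintype.card ι + l * ∑ m, N m := by
  have hprod : N i * ∏ m ∈ univ.erase i, N m = ∏ m, N m := mul_prod_erase _ _ (mem_univ i)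
  have hsum : N i + ∑ m ∈ univ.erase i, N m = ∑ m, N m := add_sum_erase _ _ (mem_univ i)
  have hcard : #(univ.erase i) + 1 = Fintype.card ι := card_erase_add_one (mem_univ i)
  by_cases hij : i = j
  · subst hij
    have h := card_mul_le_pow_add_sum (univ.erase i) N hc hl.le ha (fun m _ => hN m) hi
    have hcard' : ((#(univ.erase i) : ℝ) + 1) = Fintype.card ι := by exact_mod_cast hcard
    rw [hcard, hcard'] at h
    have : c * ∏ m, N m ≤ l * N i := by
      rw [← hprod]
      rcases (hN i).eq_or_lt with h0 | h0
      · simp [← h0]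
      · nlinarith [mul_le_mul_of_nonneg_left (hj h0) h0.le]
    rw [← hsum]
    linarith
  · have hji : j ∈ univ.erase i := by simp [Ne.symm hij]
    have hij' : i ∈ univ.erase j := by simp [hij]
    have hprod' := mul_prod_erase (univ.erase i) N hji
    have hsum' := add_sum_erase (univ.erase i) N hji
    have hprod'' := mul_prod_erase (univ.erase j) N hij'
    rw [erase_right_comm] at hprod''
    have hR0 : 0 ≤ ∏ m ∈ (univ.erase i).erase j, N m := prod_nonneg fun m _ => hN m
    set R := ∏ m ∈ (univ.erase i).erase j, N m
    rw [← hprod'] at hi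
    have hjpos : 0 < N j := (hN j).lt_of_ne fun h => by
      rw [← h] at hi; simp at hi; linarith
    have hRpos : 0 < R := hR0.lt_of_ne fun h => by
      rw [← h] at hi; simp at hi; linarith
    have hj := hj hjpos
    rw [← hprod''] at hj
    obtain ⟨b, hb⟩ : ∃ b, c * (b * R) = l := ⟨l / (c * R), by field_simp⟩
    have hb0 : 0 ≤ b := by
      by_contra! h
      nlinarith [mul_pos hc hRpos]
    have hbN : b ≤ N j := by
      by_contra! h
      nlinarith [mul_pos hc hRpos]
    have hb' : ∏ m ∈ univ.erase i, Function.update N j b m = b * R := by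
      rw [prod_update_of_mem hji, sdiff_singleton_eq_erase]
    have h := card_mul_le_pow_add_sum (univ.erase i) (Function.update N j b) hc hl.le ha
      (fun m _ => by
        rcases eq_or_ne m j with rfl | hm
        · simpa using hb0
        · simpa [hm] using hN m) (by rw [hb', hb])
    have hcard' : ((#(univ.erase i) : ℝ) + 1) = Fintype.card ι := by exact_mod_cast hcard
    rw [hcard, hcard', sum_update_of_mem hji, sdiff_singleton_eq_erase] at h
    rw [← hsum, ← hsum', ← hprod, ← hprod']
    have hbi : l * N i = c * (b * R) * N i := by rw [hb]
    linarith [mul_nonneg (sub_nonneg.2 hbN) (sub_nonneg.2 hj)]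

theorem Nbar_nonneg {M T : ℕ} {A : ℕ → ℕ → ℝ} (hA : Substochastic M T A) {x t : ℕ}
    (hx : x ∈ Icc 1 M) (ht : t ≤ T) : 0 ≤ Nbar A x t := by
  have h : ∑ s ∈ Icc 1 t, A x s ≤ ∑ s ∈ Icc 1 T, A x s :=
    sum_le_sum_of_subset_of_nonneg (Icc_subset_Icc_right ht) fun s _ _ => hA.1 x s
  have := hA.2.1 x hx
  unfold Nbar
  linarith

theorem Nbar_anti {M T : ℕ} {A : ℕ → ℕ → ℝ} (hA : Substochastic M T A) (x : ℕ) {s t : ℕ}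
    (hst : s ≤ t) : Nbar A x t ≤ Nbar A x s := by
  have h : ∑ r ∈ Icc 1 s, A x r ≤ ∑ r ∈ Icc 1 t, A x r :=
    sum_le_sum_of_subset_of_nonneg (Icc_subset_Icc_right hst) fun r _ _ => hA.1 x r
  unfold Nbar
  linarith

theorem Nbar_le_one {M T : ℕ} {A : ℕ → ℕ → ℝ} (hA : Substochastic M T A) (x t : ℕ) :
    Nbar A x t ≤ 1 := by
  have h : 0 ≤ ∑ r ∈ Icc 1 t, A x r := sum_nonneg fun r _ => hA.1 x r
  unfold Nbar
  linarith

theorem Nbar_eq_of_forall_eq_zero {A : ℕ → ℕ → ℝ} {x s t : ℕ} (hst : s ≤ t)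
    (h : ∀ r ∈ Icc 1 t, s < r → A x r = 0) : Nbar A x s = Nbar A x t := by
  unfold Nbar
  congr 1
  refine sum_subset (Icc_subset_Icc_right hst) fun r hr hr' => h r hr ?_
  simp only [mem_Icc] at hr hr'
  omega

theorem sum_one_sub_Nbar (M T : ℕ) (A : ℕ → ℕ → ℝ) :
    ∑ x ∈ Icc 1 M, (1 - Nbar A x T) = ∑ t ∈ Icc 1 T, ∑ x ∈ Icc 1 M, A x t := by
  simp only [Nbar, sub_sub_cancel]
  exact sum_comm

/-- Adding weight `ε` to the entry `(y, s)` and removing weight `δ` from the entry `(x, s)` of an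
optimal strategy is not profitable. -/
theorem mul_le_mul_of_optimal {M T : ℕ} {A w : ℕ → ℕ → ℝ} (hA : Substochastic M T A)
    (hopt : ∀ B, Substochastic M T B →
      ∑ t ∈ Icc 1 T, ∑ x ∈ Icc 1 M, B x t * w x t ≤ ∑ t ∈ Icc 1 T, ∑ x ∈ Icc 1 M, A x t * w x t)
    {x y s : ℕ} (hx : x ∈ Icc 1 M) (hy : y ∈ Icc 1 M) (hs : s ∈ Icc 1 T) {ε δ : ℝ}
    (hε : 0 ≤ ε) (hδ : 0 ≤ δ) (hεy : ε ≤ Nbar A y T) (hδx : δ ≤ A x s)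
    (hcol : ∑ z ∈ Icc 1 M, A z s + ε - δ ≤ 1) :
    ε * w y s ≤ δ * w x s := by
  let B : ℕ → ℕ → ℝ := fun z t =>
    A z t + (if t = s then if z = y then ε else 0 else 0)
      - (if t = s then if z = x then δ else 0 else 0)
  have hB : Substochastic M T B := by
    refine ⟨fun z t => ?_, fun z hz => ?_, fun t ht => ?_⟩
    · have h0 := hA.1 z t
      simp only [B]
      split_ifs <;> subst_vars <;> linarith
    · have h0 := hA.2.1 z hz
      simp only [B, sum_add_distrib, sum_sub_distrib, sum_ite_eq', hs, if_true]
      unfold Nbar at hεy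
      split_ifs <;> subst_vars <;> linarith
    · have h0 := hA.2.2 t ht
      simp only [B, sum_add_distrib, sum_sub_distrib]
      by_cases hts : t = s
      · subst hts
        simp only [if_true, sum_ite_eq', hx, hy]
        exact hcol
      · simpa [hts] using h0
  have h := hopt B hB
  simp only [B, add_mul, sub_mul, sum_add_distrib, sum_sub_distrib, ite_mul, zero_mul] at h
  have hsum : ∀ (u : ℕ) (c : ℝ), u ∈ Icc 1 M →
      ∑ t ∈ Icc 1 T, ∑ z ∈ Icc 1 M, (if t = s then if z = u then c * w z t else 0 else 0) =
        c * w u s := by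
    intro u c hu
    rw [sum_comm]
    simp [sum_ite_eq', hs, hu, -mem_Icc]
  rw [hsum y ε hy, hsum x δ hx] at h
  linarith

theorem le_of_optimal_of_pos {M T : ℕ} {A w : ℕ → ℕ → ℝ} (hA : Substochastic M T A)
    (hopt : ∀ B, Substochastic M T B →
      ∑ t ∈ Icc 1 T, ∑ x ∈ Icc 1 M, B x t * w x t ≤ ∑ t ∈ Icc 1 T, ∑ x ∈ Icc 1 M, A x t * w x t)
    {x y s : ℕ} (hx : x ∈ Icc 1 M) (hy : y ∈ Icc 1 M) (hs : s ∈ Icc 1 T)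
    (hxs : 0 < A x s) (hyT : 0 < Nbar A y T) : w y s ≤ w x s := by
  have hm : 0 < min (A x s) (Nbar A y T) := lt_min hxs hyT
  refine le_of_mul_le_mul_left (mul_le_mul_of_optimal hA hopt hx hy hs hm.le hm.le
    (min_le_right _ _) (min_le_left _ _) ?_) hm
  simpa using hA.2.2 s hs

theorem column_sum_eq_one_of_optimal {M T : ℕ} {A w : ℕ → ℕ → ℝ} (hA : Substochastic M T A)
    (hopt : ∀ B, Substochastic M T B →
      ∑ t ∈ Icc 1 T, ∑ x ∈ Icc 1 M, B x t * w x t ≤ ∑ t ∈ Icc 1 T, ∑ x ∈ Icc 1 M, A x t * w x t)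
    {y s : ℕ} (hy : y ∈ Icc 1 M) (hs : s ∈ Icc 1 T)
    (hw : 0 < w y s) (hyT : 0 < Nbar A y T) : ∑ x ∈ Icc 1 M, A x s = 1 := by
  refine (hA.2.2 s hs).antisymm ?_
  by_contra! hlt
  have hm : 0 < min (1 - ∑ x ∈ Icc 1 M, A x s) (Nbar A y T) := lt_min (by linarith) hyT
  have h := mul_le_mul_of_optimal hA hopt hy hy hs hm.le le_rfl (min_le_right _ _) (hA.1 y s)
    (by linarith [min_le_left (1 - ∑ x ∈ Icc 1 M, A x s) (Nbar A y T)])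
  nlinarith [mul_pos hm hw]

/-- The value of box `x` at round `t` against all players of the family `g` except `i`. -/
def exVal {ι : Type*} [Fintype ι] [DecidableEq ι] (f : ℕ → ℝ) (g : ι → ℕ → ℕ → ℝ) (i : ι)
    (x t : ℕ) : ℝ :=
  f x * ∏ m ∈ univ.erase i, Nbar (g m) x t

section Family

variable {ι : Type*} [Fintype ι] [DecidableEq ι] {M T : ℕ} {f : ℕ → ℝ} {g : ι → ℕ → ℕ → ℝ}

theorem exVal_nonneg (hf : ∀ x ∈ Icc 1 M, 0 < f x) (hg : ∀ i, Substochastic M T (g i)) (i : ι)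
    {x t : ℕ} (hx : x ∈ Icc 1 M) (ht : t ≤ T) : 0 ≤ exVal f g i x t :=
  mul_nonneg (hf x hx).le (prod_nonneg fun m _ => Nbar_nonneg (hg m) hx ht)

theorem exVal_anti (hf : ∀ x ∈ Icc 1 M, 0 < f x) (hg : ∀ i, Substochastic M T (g i)) (i : ι)
    {x t : ℕ} (hx : x ∈ Icc 1 M) (ht : t ≤ T) : exVal f g i x T ≤ exVal f g i x t :=
  mul_le_mul_of_nonneg_left
    (prod_le_prod (fun m _ => Nbar_nonneg (hg m) hx le_rfl) fun m _ => Nbar_anti (hg m) x ht)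
    (hf x hx).le

/-- The last player to visit a box that is visited at all values it, at the end of an equilibrium,
at least as much as every box which that player has not exhausted. -/
theorem exists_forall_exVal_le (hf : ∀ x ∈ Icc 1 M, 0 < f x) (hg : ∀ i, Substochastic M T (g i))
    (hopt : ∀ i B, Substochastic M T B →
      ∑ t ∈ Icc 1 T, ∑ x ∈ Icc 1 M, B x t * exVal f g i x t ≤
        ∑ t ∈ Icc 1 T, ∑ x ∈ Icc 1 M, g i x t * exVal f g i x t)
    {x : ℕ} (hx : x ∈ Icc 1 M) (hvisit : ∃ i, ∃ t ∈ Icc 1 T, 0 < g i x t) :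
    ∃ i, ∀ y ∈ Icc 1 M, 0 < Nbar (g i) y T → exVal f g i y T ≤ exVal f g i x T := by
  classical
  obtain ⟨i₀, t₀, ht₀, hpos₀⟩ := hvisit
  obtain ⟨s, hs, hmax⟩ := exists_max_image {t ∈ Icc 1 T | ∃ i, 0 < g i x t} id
    ⟨t₀, mem_filter.2 ⟨ht₀, i₀, hpos₀⟩⟩
  obtain ⟨hs, i, hi⟩ := mem_filter.1 hs
  have hsT : s ≤ T := (mem_Icc.1 hs).2
  have hlast : exVal f g i x s = exVal f g i x T := by
    unfold exVal
    congr 1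
    refine prod_congr rfl fun m _ => Nbar_eq_of_forall_eq_zero hsT fun r hr hsr => ?_
    by_contra hne
    exact (hmax r (mem_filter.2 ⟨hr, m, ((hg m).1 x r).lt_of_ne' hne⟩)).not_gt hsr
  refine ⟨i, fun y hy hyT => ?_⟩
  rw [← hlast]
  exact (exVal_anti hf hg i hy hsT).trans (le_of_optimal_of_pos (hg i) (hopt i) hx hy hs hi hyT)

/-- The failure probability of an equilibrium family is at most that of a symmetric profile. -/
theorem sum_mul_prod_Nbar_le (hM : 1 ≤ M) (hι : Nonempty ι) (hf : ∀ x ∈ Icc 1 M, 0 < f x)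
    (hg : ∀ i, Substochastic M T (g i))
    (hopt : ∀ i B, Substochastic M T B →
      ∑ t ∈ Icc 1 T, ∑ x ∈ Icc 1 M, B x t * exVal f g i x t ≤
        ∑ t ∈ Icc 1 T, ∑ x ∈ Icc 1 M, g i x t * exVal f g i x t)
    {A : ℕ → ℕ → ℝ} (hA : Substochastic M T A) :
    ∑ x ∈ Icc 1 M, f x * ∏ i, Nbar (g i) x T ≤
      ∑ x ∈ Icc 1 M, f x * Nbar A x T ^ Fintype.card ι := by
  let h : ι → ℕ → ℝ := fun i y => if 0 < Nbar (g i) y T then exVal f g i y T else 0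
  have hboxes : (Icc 1 M).Nonempty := ⟨1, by simpa using hM⟩
  choose y hy hymax using fun i => exists_max_image (Icc 1 M) (h i) hboxes
  obtain ⟨j, -, hj⟩ := exists_min_image univ (fun i => h i (y i)) univ_nonempty
  obtain ⟨l, hl⟩ : ∃ l, l = h j (y j) := ⟨_, rfl⟩
  have hl0 : 0 ≤ l := by
    rw [hl]
    simp only [h]
    split_ifs
    · exact exVal_nonneg hf hg j (hy j) le_rfl
    · exact le_rfl
  have hjl : ∀ x ∈ Icc 1 M, 0 < Nbar (g j) x T → exVal f g j x T ≤ l := fun x hx hpos => by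
    simpa [h, hpos, hl] using hymax j x hx
  have hprod : ∀ (i : ι) (x : ℕ), Nbar (g i) x T * exVal f g i x T = f x * ∏ m, Nbar (g m) x T :=
    fun i x => by
      rw [exVal, mul_left_comm, mul_prod_erase univ (fun m => Nbar (g m) x T) (mem_univ i)]
  rcases hl0.eq_or_lt with hl0 | hl0
  · refine sum_le_sum fun x hx => le_trans ?_ (mul_nonneg (hf x hx).le
      (pow_nonneg (Nbar_nonneg hA hx le_rfl) _))
    rw [← hprod j]
    rcases (Nbar_nonneg (hg j) hx le_rfl).eq_or_lt with h0 | h0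
    · simp [← h0]
    · exact mul_nonpos_of_nonneg_of_nonpos h0.le (hl0 ▸ hjl x hx h0)
  have hy' : ∀ i, 0 < Nbar (g i) (y i) T ∧ l ≤ exVal f g i (y i) T := fun i => by
    have hi : l ≤ h i (y i) := hl ▸ hj i (mem_univ i)
    by_cases hpos : 0 < Nbar (g i) (y i) T
    · exact ⟨hpos, by simpa [h, hpos] using hi⟩
    · simp only [h, hpos, if_false] at hi
      linarith
  have hfull : ∀ i, ∑ x ∈ Icc 1 M, (1 - Nbar (g i) x T) = T := fun i => by
    rw [sum_one_sub_Nbar, sum_congr rfl fun t ht => column_sum_eq_one_of_optimal (hg i) (hopt i)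
      (hy i) ht ((hl0.trans_le (hy' i).2).trans_le (exVal_anti hf hg i (hy i) (mem_Icc.1 ht).2))
      (hy' i).1]
    simp
  have hpoint : ∀ x ∈ Icc 1 M,
      f x * ∏ i, Nbar (g i) x T + Fintype.card ι * l * Nbar A x T ≤
        f x * Nbar A x T ^ Fintype.card ι + l * ∑ i, Nbar (g i) x T := by
    intro x hx
    by_cases hvisit : ∃ i, ∃ t ∈ Icc 1 T, 0 < g i x t
    · obtain ⟨i, hi⟩ := exists_forall_exVal_le hf hg hopt hx hvisit
      exact mul_prod_add_le (fun m => Nbar (g m) x T) (hf x hx) hl0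
        (Nbar_nonneg hA hx le_rfl) (fun m => Nbar_nonneg (hg m) hx le_rfl) i j
        ((hy' i).2.trans (hi (y i) (hy i) (hy' i).1)) (hjl x hx)
    · have hone : ∀ i, Nbar (g i) x T = 1 := fun i => by
        rw [Nbar, sub_eq_self]
        refine sum_eq_zero fun t ht => ?_
        by_contra hne
        exact hvisit ⟨i, t, ht, ((hg i).1 x t).lt_of_ne' hne⟩
      have hfl : f x ≤ l := by simpa [exVal, hone] using hjl x hx (by simp [hone])
      have hbern := one_add_mul_sub_le_pow (a := Nbar A x T)
        (by linarith [Nbar_nonneg hA hx le_rfl]) (Fintype.card ι)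
      have hslack : 0 ≤ (Fintype.card ι : ℝ) * ((1 - Nbar A x T) * (l - f x)) :=
        mul_nonneg (Nat.cast_nonneg _)
          (mul_nonneg (sub_nonneg.2 (Nbar_le_one hA x T)) (sub_nonneg.2 hfl))
      simp only [hone, prod_const_one, sum_const, card_univ, nsmul_eq_mul, mul_one]
      linarith [mul_le_mul_of_nonneg_left hbern (hf x hx).le]
  have htotal := sum_le_sum hpoint
  simp only [sum_add_distrib, ← mul_sum] at htotal
  have hAT : (M : ℝ) - T ≤ ∑ x ∈ Icc 1 M, Nbar A x T := by
    have h1 : ∑ x ∈ Icc 1 M, (1 - Nbar A x T) ≤ T := by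
      rw [sum_one_sub_Nbar]
      simpa using sum_le_sum hA.2.2
    simp at h1
    linarith
  have hgT : ∑ x ∈ Icc 1 M, ∑ i, Nbar (g i) x T = Fintype.card ι * ((M : ℝ) - T) := by
    rw [sum_comm, sum_congr rfl fun i _ => show _ = (M : ℝ) - T by
      have := hfull i
      simp at this
      linarith]
    simp [mul_sub]
  rw [hgT] at htotal
  have hcl : 0 ≤ (Fintype.card ι : ℝ) * l := by positivity
  linarith [mul_le_mul_of_nonneg_left hAT hcl]

end Family

/-- under the exclusive policy, any equilibrium profile of `k` strategies has
success probability at least that of any symmetric profile `A^k`. -/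
theorem equilibrium_beats_symmetric
    (M T k : ℕ) (hM : 1 ≤ M) (hT : 1 ≤ T) (hk : 2 ≤ k)
    (f : ℕ → ℝ) (hf : BoxDist M f)
    (P : Multiset (ℕ → ℕ → ℝ)) (hcard : Multiset.card P = k)
    (hsub : ∀ A ∈ P, Substochastic M T A)
    (hnash : ∀ A ∈ P, ∀ B, Substochastic M T B →
      pexUtil M T f (P.erase A) B ≤ pexUtil M T f (P.erase A) A)
    (A : ℕ → ℕ → ℝ) (hA : Substochastic M T A) :
    success M T f (Multiset.replicate k A) ≤ success M T f P := by
  obtain ⟨n, g, rfl⟩ : ∃ (n : ℕ) (g : Fin n → ℕ → ℕ → ℝ), P = univ.val.map g :=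
    ⟨P.toList.length, P.toList.get, by
      rw [Fin.univ_val_map, List.ofFn_get, Multiset.coe_toList]⟩
  obtain rfl : n = k := by simpa using hcard
  have hmem : ∀ i, g i ∈ univ.val.map g := fun i => Multiset.mem_map_of_mem g (mem_univ i)
  have herase : ∀ i x t, pexVal f ((univ.val.map g).erase (g i)) x t = exVal f g i x t := by
    intro i x t
    have hcons : univ.val.map g = g i ::ₘ (univ.erase i).val.map g := by
      rw [← Multiset.map_cons, erase_val, Multiset.cons_erase (mem_univ i)]
    rw [hcons, Multiset.erase_cons_head, pexVal, Multiset.map_map]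
    rfl
  have h := sum_mul_prod_Nbar_le hM ⟨⟨0, by omega⟩⟩ hf.1 (fun i => hsub _ (hmem i))
    (fun i B hB => by simpa only [pexUtil, herase] using hnash _ (hmem i) B hB) hA
  have hP : ∀ x, (((univ.val.map g).map fun B => Nbar B x T).prod) = ∏ i, Nbar (g i) x T :=
    fun x => by rw [Multiset.map_map]; rfl
  simp only [success, hP, Multiset.map_replicate, Multiset.prod_replicate, mul_sub, mul_one,
    sum_sub_distrib]
  rw [Fintype.card_fin] at h
  linarith
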